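/- Let Φ : V^{⊗n} → W̃_{z₁,…,zₙ} be composable with m vertex operators, and let p, q ∈ ℤ₊ with p + q ≤ m. Then E^{(p)}_W ∘_{p+1} (E^{(q)}_W ∘_{q+1} Φ) = E^{(p+q)}_W ∘_{p+q+1} Φ. -/

import Mathlib

open scoped BigOperators Classical

noncomputable section VertexCohomology

/-! ## Rational functions with prescribed poles -/

/-- A function of `n` complex variables (restricted to the configuration space of
pairwise distinct points) which is a rational function with the only possible poles
on the diagonals `z i = z j`, `i ≠ j`. -/
def RatDiag (n : ℕ) (f : (Fin n → ℂ) → ℂ) : Prop :=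
  ∃ (P : MvPolynomial (Fin n) ℂ) (N : ℕ),
    ∀ z : Fin n → ℂ, (∀ i j : Fin n, i ≠ j → z i ≠ z j) →
      f z * ∏ i : Fin n, ∏ j : Fin n, (if i < j then (z i - z j) ^ N else 1)
        = MvPolynomial.eval z P

/-- A rational function of `n` variables with the only possible poles at
`z i = z j` (`i ≠ j`) and `z i = 0`. -/
def RatFull (n : ℕ) (f : (Fin n → ℂ) → ℂ) : Prop :=
  ∃ (P : MvPolynomial (Fin n) ℂ) (N : ℕ),
    ∀ z : Fin n → ℂ, (∀ i, z i ≠ 0) → (∀ i j : Fin n, i ≠ j → z i ≠ z j) →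
      f z * ((∏ i : Fin n, z i ^ N) *
        ∏ i : Fin n, ∏ j : Fin n, (if i < j then (z i - z j) ^ N else 1))
        = MvPolynomial.eval z P

/-- A rational function of `n` variables with the only possible poles at
`z i = z j` (`i ≠ j`), the pole at `z i = z j` being of order at most `Nb i j`. -/
def RatDiagBnd (n : ℕ) (Nb : Fin n → Fin n → ℕ) (f : (Fin n → ℂ) → ℂ) : Prop :=
  ∃ P : MvPolynomial (Fin n) ℂ,
    ∀ z : Fin n → ℂ, (∀ i j : Fin n, i ≠ j → z i ≠ z j) →
      f z * ∏ i : Fin n, ∏ j : Fin n, (if i < j then (z i - z j) ^ (Nb i j) else 1)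
        = MvPolynomial.eval z P

/-- A rational function of one variable with the only possible pole at `0`. -/
def RatOne (f : ℂ → ℂ) : Prop :=
  ∃ (P : Polynomial ℂ) (N : ℕ), ∀ z : ℂ, z ≠ 0 → f z * z ^ N = Polynomial.eval z P

/-! ## Graded duals -/

/-- A linear functional on a `ℤ`-graded space belonging to the graded (restricted) dual:
it is nonzero on only finitely many homogeneous subspaces. -/
def GradedFunctionalZ {V : Type} [AddCommGroup V] [Module ℂ V]
    (grading : ℤ → Submodule ℂ V) (f : V →ₗ[ℂ] ℂ) : Prop :=
  {k : ℤ | ∃ v ∈ grading k, f v ≠ 0}.Finite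

/-- A linear functional on a `ℂ`-graded space belonging to the graded (restricted) dual. -/
def GradedFunctionalC {W : Type} [AddCommGroup W] [Module ℂ W]
    (grading : ℂ → Submodule ℂ W) (f : W →ₗ[ℂ] ℂ) : Prop :=
  {c : ℂ | ∃ w ∈ grading c, f w ≠ 0}.Finite

/-! ## Grading-restricted vertex algebras and modules -/

variable (V : Type) [AddCommGroup V] [Module ℂ V]
variable (W : Type) [AddCommGroup W] [Module ℂ W]

/-- A grading-restricted vertex algebra structure on `V`, with the duality property
(for products and iterates of two vertex operators) as the main axiom.
`Y u v k` denotes the coefficient `(Y_V)_k(u)v` of `x^{-k-1}` in `Y_V(u,x)v`. -/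
structure GRVA where
  grading : ℤ → Submodule ℂ V
  decomp : DirectSum.Decomposition grading
  finiteDim : ∀ k : ℤ, Module.Finite ℂ (grading k)
  lower_bounded : ∃ N : ℤ, ∀ k : ℤ, k < N → grading k = ⊥
  Y : V →ₗ[ℂ] V →ₗ[ℂ] (ℤ → V)
  vacuum : V
  vacuum_mem : vacuum ∈ grading 0
  trunc : ∀ u v : V, ∃ N : ℤ, ∀ k : ℤ, N ≤ k → Y u v k = 0
  identity : ∀ (v : V) (k : ℤ), Y vacuum v k = if k = -1 then v else 0
  creation : ∀ (u : V) (k : ℤ), 0 ≤ k → Y u vacuum k = 0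
  creation_lim : ∀ u : V, Y u vacuum (-1) = u
  L0 : Module.End ℂ V
  L0_eq : ∀ (k : ℤ) (v : V), v ∈ grading k → L0 v = (k : ℂ) • v
  Lm1 : Module.End ℂ V
  Lm1_eq : ∀ v : V, Lm1 v = Y v vacuum (-2)
  L0_bracket : ∀ (u v : V) (k : ℤ), L0 (Y u v k)
      = Y (L0 u) v k + Y u (L0 v) k + ((-k - 1 : ℤ) : ℂ) • Y u v k
  Lm1_deriv : ∀ (u v : V) (k : ℤ), Y (Lm1 u) v k = (-k : ℂ) • Y u v (k - 1)
  Lm1_bracket : ∀ (u v : V) (k : ℤ),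
      Lm1 (Y u v k) - Y u (Lm1 v) k = (-k : ℂ) • Y u v (k - 1)
  duality : ∀ (u₁ u₂ v : V) (v' : V →ₗ[ℂ] ℂ), GradedFunctionalZ grading v' →
    ∃ f : (Fin 2 → ℂ) → ℂ, RatFull 2 f ∧
      (∀ z₁ z₂ : ℂ, ‖z₁‖ > ‖z₂‖ → z₂ ≠ 0 →
        HasSum (fun k : ℤ × ℤ =>
          v' (Y u₁ (Y u₂ v k.2) k.1) * z₁ ^ (-k.1 - 1) * z₂ ^ (-k.2 - 1)) (f ![z₁, z₂])) ∧
      (∀ z₁ z₂ : ℂ, ‖z₂‖ > ‖z₁‖ → z₁ ≠ 0 →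
        HasSum (fun k : ℤ × ℤ =>
          v' (Y u₂ (Y u₁ v k.1) k.2) * z₁ ^ (-k.1 - 1) * z₂ ^ (-k.2 - 1)) (f ![z₁, z₂])) ∧
      (∀ z₁ z₂ : ℂ, ‖z₂‖ > ‖z₁ - z₂‖ → z₁ ≠ z₂ → z₂ ≠ 0 →
        HasSum (fun k : ℤ × ℤ =>
          v' (Y (Y u₁ u₂ k.1) v k.2) * (z₁ - z₂) ^ (-k.1 - 1) * z₂ ^ (-k.2 - 1))
          (f ![z₁, z₂]))

/-- A grading-restricted generalized module structure on `W` for a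
grading-restricted vertex algebra structure `A` on `V`. -/
structure GRMod (A : GRVA V) where
  grading : ℂ → Submodule ℂ W
  decomp : DirectSum.Decomposition grading
  lower_trunc : ∃ N : ℝ, ∀ c : ℂ, c.re < N → grading c = ⊥
  Y : V →ₗ[ℂ] W →ₗ[ℂ] (ℤ → W)
  trunc : ∀ (u : V) (w : W), ∃ N : ℤ, ∀ k : ℤ, N ≤ k → Y u w k = 0
  identity : ∀ (w : W) (k : ℤ), Y A.vacuum w k = if k = -1 then w else 0
  L0 : Module.End ℂ W
  Lm1 : Module.End ℂ W
  L0_mem : ∀ (c : ℂ) (w : W), w ∈ grading c → L0 w ∈ grading c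
  Lm1_mem : ∀ (c : ℂ) (w : W), w ∈ grading c → Lm1 w ∈ grading (c + 1)
  L0_bracket : ∀ (u : V) (w : W) (k : ℤ), L0 (Y u w k)
      = Y (A.L0 u) w k + Y u (L0 w) k + ((-k - 1 : ℤ) : ℂ) • Y u w k
  L0_nilpotent : ∀ (c : ℂ) (w : W), w ∈ grading c →
      ∃ K : ℕ, ((L0 - c • 1) ^ K) w = 0
  Lm1_deriv : ∀ (u : V) (w : W) (k : ℤ), Y (A.Lm1 u) w k = (-k : ℂ) • Y u w (k - 1)
  Lm1_bracket : ∀ (u : V) (w : W) (k : ℤ),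
      Lm1 (Y u w k) - Y u (Lm1 w) k = (-k : ℂ) • Y u w (k - 1)
  duality : ∀ (u₁ u₂ : V) (w : W) (w' : W →ₗ[ℂ] ℂ), GradedFunctionalC grading w' →
    ∃ f : (Fin 2 → ℂ) → ℂ, RatFull 2 f ∧
      (∀ z₁ z₂ : ℂ, ‖z₁‖ > ‖z₂‖ → z₂ ≠ 0 →
        HasSum (fun k : ℤ × ℤ =>
          w' (Y u₁ (Y u₂ w k.2) k.1) * z₁ ^ (-k.1 - 1) * z₂ ^ (-k.2 - 1)) (f ![z₁, z₂])) ∧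
      (∀ z₁ z₂ : ℂ, ‖z₂‖ > ‖z₁‖ → z₁ ≠ 0 →
        HasSum (fun k : ℤ × ℤ =>
          w' (Y u₂ (Y u₁ w k.1) k.2) * z₁ ^ (-k.1 - 1) * z₂ ^ (-k.2 - 1)) (f ![z₁, z₂])) ∧
      (∀ z₁ z₂ : ℂ, ‖z₂‖ > ‖z₁ - z₂‖ → z₁ ≠ z₂ → z₂ ≠ 0 →
        HasSum (fun k : ℤ × ℤ =>
          w' (Y (A.Y u₁ u₂ k.1) w k.2) * (z₁ - z₂) ^ (-k.1 - 1) * z₂ ^ (-k.2 - 1))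
          (f ![z₁, z₂]))

variable {V W}

/-! ## Algebraic completions -/

/-- The algebraic completion `W̄ = ∏_{c ∈ ℂ} W_(c)` of a `ℂ`-graded module. -/
abbrev WbarT {A : GRVA V} (M : GRMod V W A) : Type := ∀ c : ℂ, M.grading c

/-- The algebraic completion `V̄ = ∏_{k ∈ ℤ} V_(k)`. -/
abbrev VbarT (A : GRVA V) : Type := ∀ k : ℤ, A.grading k

/-- The pairing `⟨w', ω⟩` of an element `w'` of the graded dual `W'` with an
element `ω` of the algebraic completion `W̄`. -/
def pairBar {A : GRVA V} {M : GRMod V W A} (w' : W →ₗ[ℂ] ℂ) (ω : WbarT M) : ℂ :=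
  ∑ᶠ c : ℂ, w' (ω c : W)

/-- The pairing of an element of the graded dual `V'` with an element of `V̄`. -/
def pairBarV {A : GRVA V} (v' : V →ₗ[ℂ] ℂ) (ω : VbarT A) : ℂ :=
  ∑ᶠ k : ℤ, v' (ω k : V)

/-- The homogeneous component `P_r ω ∈ V` of `ω ∈ V̄` for `r ∈ ℂ`
(zero when `r` is not an integer). -/
def VbarComp {A : GRVA V} (ω : VbarT A) (r : ℂ) : V :=
  if h : ∃ k : ℤ, (k : ℂ) = r then (ω h.choose : V) else 0

/-! ## Iterated vertex operators -/

/-- `applyList Yop v k L w` applies the coefficients `(Yop (v t)) · (k t)` of the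
vertex operators at the positions listed in `L` (head outermost) to `w`. -/
def applyList {X : Type} [AddCommGroup X] [Module ℂ X] {n : ℕ}
    (Yop : V →ₗ[ℂ] X →ₗ[ℂ] (ℤ → X)) (v : Fin n → V) (k : Fin n → ℤ) :
    List (Fin n) → X → X
  | [], w => w
  | t :: ts, w => Yop (v t) (applyList Yop v k ts w) (k t)

/-- The coefficient of `z^{-p-1}` in `Y^W_{WV}(w, z)v = e^{zL_W(-1)} Y_W(v, -z)w`. -/
def YWVcoef {A : GRVA V} (M : GRMod V W A) (w : W) (v : V) (p : ℤ) : W :=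
  ∑ᶠ m : ℕ, (((m.factorial : ℂ))⁻¹ * (-1 : ℂ) ^ ((m : ℤ) - p)) •
    ((M.Lm1 ^ m) (M.Y v w ((m : ℤ) - p - 1)))

/-! ## The `E`-families: products of vertex operators with values in completions -/

/-- `IsEVFam A EV` says that `EV l v z ∈ V̄` realizes
`(E^{(l)}_V(v₁ ⊗ ⋯ ⊗ v_l; 𝟏))(z₁, …, z_l) = E(Y_V(v₁,z₁) ⋯ Y_V(v_l,z_l)𝟏)`:
its pairing with every graded functional `v'` is the rational extension (with only
possible poles on the diagonals) of the series of products of `l` vertex operators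
acting on the vacuum, which converges in the region `|z₁| > ⋯ > |z_l| > 0`. -/
def IsEVFam (A : GRVA V) (EV : ∀ l : ℕ, (Fin l → V) → (Fin l → ℂ) → VbarT A) : Prop :=
  ∀ (l : ℕ) (v : Fin l → V) (v' : V →ₗ[ℂ] ℂ), GradedFunctionalZ A.grading v' →
    ∃ f : (Fin l → ℂ) → ℂ, RatDiag l f ∧
      (∀ z : Fin l → ℂ, (List.finRange l).Chain' (fun s t => ‖z s‖ > ‖z t‖) →
          (∀ t, z t ≠ 0) →
        HasSum (fun k : Fin l → ℤ =>
          v' (applyList A.Y v k (List.finRange l) A.vacuum) *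
            ∏ t, z t ^ (-(k t) - 1)) (f z)) ∧
      (∀ z, (∀ s t, s ≠ t → z s ≠ z t) → pairBarV v' (EV l v z) = f z)

/-- `IsEWFam A M EW` says that `EW m v u z ∈ W̄` realizes
`(E^{(m)}_W(v₁ ⊗ ⋯ ⊗ v_m; u))(z₁, …, z_m) = E(Y_W(v₁,z₁) ⋯ Y_W(v_m,z_m)u)`:
its pairing with every graded functional `w'` is the rational extension (with only
possible poles at `z i = z j` and `z i = 0`) of the series of products of `m` module
vertex operators acting on `u`, convergent for `|z₁| > ⋯ > |z_m| > 0`. -/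
def IsEWFam {A : GRVA V} (M : GRMod V W A)
    (EW : ∀ m : ℕ, (Fin m → V) → W → (Fin m → ℂ) → WbarT M) : Prop :=
  ∀ (m : ℕ) (v : Fin m → V) (u : W) (w' : W →ₗ[ℂ] ℂ), GradedFunctionalC M.grading w' →
    ∃ f : (Fin m → ℂ) → ℂ, RatFull m f ∧
      (∀ z : Fin m → ℂ, (List.finRange m).Chain' (fun s t => ‖z s‖ > ‖z t‖) →
          (∀ t, z t ≠ 0) →
        HasSum (fun k : Fin m → ℤ =>
          w' (applyList M.Y v k (List.finRange m) u) *
            ∏ t, z t ^ (-(k t) - 1)) (f z)) ∧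
      (∀ z, (∀ s t, s ≠ t → z s ≠ z t) → (∀ t, z t ≠ 0) →
        pairBar w' (EW m v u z) = f z)

/-- `IsEWV1Fam A M G` says that `G m u v ζz ∈ W̄` realizes
`(E^{W;(1,m)}_{WV}(u; v₁ ⊗ ⋯ ⊗ v_m))(ζ, z₁, …, z_m)
  = E(Y^W_{WV}(u,ζ) Y_V(v₁,z₁) ⋯ Y_V(v_m,z_m)𝟏)`
(first variable is the `ζ`-slot of `Y^W_{WV}`): its pairing with every graded
functional is the rational extension (poles only on diagonals) of the corresponding
series, convergent for `|ζ| > |z₁| > ⋯ > |z_m| > 0`. -/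
def IsEWV1Fam {A : GRVA V} (M : GRMod V W A)
    (G : ∀ m : ℕ, W → (Fin m → V) → (Fin (m + 1) → ℂ) → WbarT M) : Prop :=
  ∀ (m : ℕ) (u : W) (v : Fin m → V) (w' : W →ₗ[ℂ] ℂ), GradedFunctionalC M.grading w' →
    ∃ f : (Fin (m + 1) → ℂ) → ℂ, RatDiag (m + 1) f ∧
      (∀ z : Fin (m + 1) → ℂ,
          (List.finRange (m + 1)).Chain' (fun s t => ‖z s‖ > ‖z t‖) →
          (∀ t, z t ≠ 0) →
        HasSum (fun k : Fin (m + 1) → ℤ =>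
          w' (YWVcoef M u
              (applyList A.Y v (fun t => k t.succ) (List.finRange m) A.vacuum) (k 0)) *
            ∏ t, z t ^ (-(k t) - 1)) (f z)) ∧
      (∀ z, (∀ s t, s ≠ t → z s ≠ z t) → pairBar w' (G m u v z) = f z)

/-- `IsEn1Fam A M E` says that `E m v u zζ ∈ W̄` realizes
`(E^{(m,1)}_W(v₁ ⊗ ⋯ ⊗ v_m; u))(z₁, …, z_m, ζ)
  = E(Y_W(v₁,z₁) ⋯ Y_W(v_m,z_m) Y^W_{WV}(u,ζ)𝟏)`
(the last variable is the `ζ`-slot): its pairing with every graded functional is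
the rational extension (poles only on diagonals) of the corresponding series,
convergent for `|z₁| > ⋯ > |z_m| > |ζ| > 0`. -/
def IsEn1Fam {A : GRVA V} (M : GRMod V W A)
    (E : ∀ m : ℕ, (Fin m → V) → W → (Fin (m + 1) → ℂ) → WbarT M) : Prop :=
  ∀ (m : ℕ) (v : Fin m → V) (u : W) (w' : W →ₗ[ℂ] ℂ), GradedFunctionalC M.grading w' →
    ∃ f : (Fin (m + 1) → ℂ) → ℂ, RatDiag (m + 1) f ∧
      (∀ z : Fin (m + 1) → ℂ,
          (List.finRange (m + 1)).Chain' (fun s t => ‖z s‖ > ‖z t‖) →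
          (∀ t, z t ≠ 0) →
        HasSum (fun k : Fin (m + 1) → ℤ =>
          w' (applyList M.Y v (fun t => k t.castSucc) (List.finRange m)
              (YWVcoef M u A.vacuum (k (Fin.last m)))) *
            ∏ t, z t ^ (-(k t) - 1)) (f z)) ∧
      (∀ z, (∀ s t, s ≠ t → z s ≠ z t) → pairBar w' (E m v u z) = f z)

/-! ## Cochains -/

/-- The space of `n`-cochains: linear maps from `V^{⊗n}` to the space of functions
from `n`-tuples of complex numbers to `W̄` (only the restriction to the configuration
space `F_nℂ` is relevant; `W̄`-valued rationality is imposed separately). -/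
abbrev Cochain {A : GRVA V} (M : GRMod V W A) (n : ℕ) :=
  MultilinearMap ℂ (fun _ : Fin n => V) ((Fin n → ℂ) → WbarT M)

/-- `Φ` takes values in `W̄`-valued rational functions with the only possible poles
at `z i = z j`, `i ≠ j` (i.e. in `W̃_{z₁,…,zₙ}`). -/
def TakesRatValues {A : GRVA V} {M : GRMod V W A} {n : ℕ} (Φ : Cochain M n) : Prop :=
  ∀ (v : Fin n → V) (w' : W →ₗ[ℂ] ℂ), GradedFunctionalC M.grading w' →
    RatDiag n (fun z => pairBar w' (Φ v z))

/-- Pre-composition of the complex variables with an equivalence, as a linear map. -/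
def precompZ {X : Type} [AddCommGroup X] [Module ℂ X] {a b : ℕ} (e : Fin a ≃ Fin b) :
    ((Fin a → ℂ) → X) →ₗ[ℂ] ((Fin b → ℂ) → X) where
  toFun f := fun zb => f (fun i => zb (e i))
  map_add' _ _ := rfl
  map_smul' _ _ := rfl

/-- Transport of a cochain along an identification of index sets; for `e = σ ∈ Sₙ`
this is the action `(σ(Φ))(v₁ ⊗ ⋯ ⊗ vₙ) = σ(Φ(v_{σ(1)} ⊗ ⋯ ⊗ v_{σ(n)}))`,
i.e. `(transport σ Φ) v z = Φ (v ∘ σ) (z ∘ σ)`. -/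
def transport {A : GRVA V} {M : GRMod V W A} {a b : ℕ} (e : Fin a ≃ Fin b)
    (Φ : Cochain M a) : Cochain M b :=
  (precompZ e).compMultilinearMap (MultilinearMap.domDomCongr e Φ)
/-! ## Operators on the algebraic completion -/

lemma Lm1_pow_mem {A : GRVA V} (M : GRMod V W A) (m : ℕ) (c : ℂ) (w : W)
    (h : w ∈ M.grading c) : (M.Lm1 ^ m) w ∈ M.grading (c + m) := by
  induction m generalizing c w with
  | zero => simpa using h
  | succ K ih =>
    have h1 : (M.Lm1 ^ (K + 1)) w = (M.Lm1 ^ K) (M.Lm1 w) := by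
      rw [pow_succ]; rfl
    have h2 := ih (c + 1) (M.Lm1 w) (M.Lm1_mem c w h)
    have h3 : c + 1 + (K : ℂ) = c + ((K : ℕ) + 1 : ℕ) := by push_cast; ring
    rw [h1]
    rw [h3] at h2
    exact h2

/-- The extension of `L_W(-1)` to the algebraic completion `W̄`. -/
def Lm1bar {A : GRVA V} (M : GRMod V W A) (ω : WbarT M) : WbarT M := fun c =>
  ⟨M.Lm1 (ω (c - 1) : W), by
    have h := M.Lm1_mem (c - 1) _ (ω (c - 1)).2
    have h2 : c - 1 + 1 = c := by ring
    rwa [h2] at h⟩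

/-- The operator `e^{ζ L_W(-1)}` on the algebraic completion `W̄`, well defined
componentwise thanks to the shift of weights and lower truncation. -/
def expLm1 {A : GRVA V} (M : GRMod V W A) (ζ : ℂ) (ω : WbarT M) : WbarT M := fun c =>
  ∑ᶠ m : ℕ, ((ζ ^ m * ((m.factorial : ℂ))⁻¹) •
    (⟨(M.Lm1 ^ m) (ω (c - m) : W), by
        have h := Lm1_pow_mem M m (c - m) _ (ω (c - m)).2
        have h2 : c - (m : ℂ) + m = c := by ring
        rwa [h2] at h⟩ : M.grading c))

lemma L0nil_mem {A : GRVA V} (M : GRMod V W A) (K : ℕ) (c : ℂ) (w : W)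
    (h : w ∈ M.grading c) : ((M.L0 - c • 1) ^ K) w ∈ M.grading c := by
  induction K generalizing w with
  | zero => simpa using h
  | succ K ih =>
    have h1 : ((M.L0 - c • 1) ^ (K + 1)) w = ((M.L0 - c • 1) ^ K) ((M.L0 - c • 1) w) := by
      rw [pow_succ]; rfl
    rw [h1]
    apply ih
    have h2 : (M.L0 - c • 1) w = M.L0 w - c • w := by
      simp [LinearMap.sub_apply]
    rw [h2]
    exact Submodule.sub_mem _ (M.L0_mem c w h) (Submodule.smul_mem _ c h)

/-- The operator `z^{L_W(0)} = e^{(log z)(L_W(0))_s} e^{(log z)(L_W(0)-(L_W(0))_s)}`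
on the algebraic completion `W̄`, defined using the semisimple part (which acts on
`W_(c)` as multiplication by `c`) and the locally nilpotent part of `L_W(0)`. -/
def zL0bar {A : GRVA V} (M : GRMod V W A) (z : ℂ) (ω : WbarT M) : WbarT M := fun c =>
  Complex.exp (Complex.log z * c) •
    ∑ᶠ K : ℕ, (((Complex.log z) ^ K * ((K.factorial : ℂ))⁻¹) •
      (⟨((M.L0 - c • 1) ^ K) (ω c : W), L0nil_mem M K c _ (ω c).2⟩ : M.grading c))

/-- The operator `z^{L_V(0)}` on `V` (semisimple, integral weights). -/
def zL0V (A : GRVA V) (z : ℂ) (v : V) : V :=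
  letI := A.decomp
  ∑ᶠ k : ℤ, (z ^ k) • ((DirectSum.decompose A.grading v k : V))

/-! ## The `L(-1)`-derivative and `L(0)`-conjugation properties -/

/-- The `L(-1)`-derivative property for a cochain `Φ`. -/
def HasL1D {A : GRVA V} {M : GRMod V W A} {n : ℕ} (Φ : Cochain M n) : Prop :=
  (∀ (v : Fin n → V) (w' : W →ₗ[ℂ] ℂ), GradedFunctionalC M.grading w' →
    ∀ (i : Fin n) (z : Fin n → ℂ), (∀ s t, s ≠ t → z s ≠ z t) →
      HasDerivAt (fun t => pairBar w' (Φ v (Function.update z i t)))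
        (pairBar w' (Φ (Function.update v i (A.Lm1 (v i))) z)) (z i)) ∧
  (∀ (v : Fin n → V) (w' : W →ₗ[ℂ] ℂ), GradedFunctionalC M.grading w' →
    ∀ z : Fin n → ℂ, (∀ s t, s ≠ t → z s ≠ z t) →
      ∑ i : Fin n, pairBar w' (Φ (Function.update v i (A.Lm1 (v i))) z)
        = pairBar w' (Lm1bar M (Φ v z)))

/-- The `L(0)`-conjugation property for a cochain `Φ`. -/
def HasL0conj {A : GRVA V} {M : GRMod V W A} {n : ℕ} (Φ : Cochain M n) : Prop :=
  ∀ (v : Fin n → V) (w' : W →ₗ[ℂ] ℂ), GradedFunctionalC M.grading w' →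
    ∀ (z : ℂ) (zs : Fin n → ℂ), z ≠ 0 → (∀ s t, s ≠ t → zs s ≠ zs t) →
      pairBar w' (zL0bar M z (Φ v zs))
        = pairBar w' (Φ (fun i => zL0V A z (v i)) (fun i => z * zs i))
/-! ## Block embeddings -/

/-- Starting index of the `i`-th block of sizes `l`. -/
def blockStart {n : ℕ} (l : Fin n → ℕ) (i : Fin n) : ℕ :=
  ∑ j ∈ Finset.univ.filter (fun j => j < i), l j

lemma blockEmb_lt {n m : ℕ} (l : Fin n → ℕ) (hsum : ∑ i, l i = m) (i : Fin n)
    (p : Fin (l i)) : blockStart l i + (p : ℕ) < m := by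
  have hp : (p : ℕ) < l i := p.2
  have h2 : blockStart l i + l i ≤ m := by
    rw [← hsum]
    have hnotin : i ∉ Finset.univ.filter (fun j => j < i) := by simp
    have : blockStart l i + l i = ∑ j ∈ insert i (Finset.univ.filter (fun j => j < i)), l j := by
      rw [Finset.sum_insert hnotin, Nat.add_comm]; rfl
    rw [this]
    exact Finset.sum_le_sum_of_subset (by intro x _; simp)
  omega

/-- The embedding of the `p`-th position of the `i`-th block into `Fin m`,
where the blocks have sizes `l 0, …, l (n-1)` with `∑ l = m`. -/
def blockEmb {n m : ℕ} (l : Fin n → ℕ) (hsum : ∑ i, l i = m) (i : Fin n)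
    (p : Fin (l i)) : Fin m :=
  ⟨blockStart l i + (p : ℕ), blockEmb_lt l hsum i p⟩

/-! ## Composability with vertex operators -/

/-- `Φ : V^{⊗n} → W̃` is composable with `m` vertex operators (Definition 3.3):
the two families of series obtained by substituting products of vertex operators
acting on the vacuum into the arguments of `Φ` (condition 1) and by applying `m`
module vertex operators to the value of `Φ` (condition 2) converge absolutely in
the indicated regions to rational functions with only possible poles at
`z i = z j` of orders bounded by positive integers `N(v i, v j)` depending only
on `v i` and `v j`.  The auxiliary `V̄`- and `W̄`-valued products are encoded by
families `EV`, `EW` satisfying `IsEVFam`, `IsEWFam`. -/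
def Composable {A : GRVA V} {M : GRMod V W A}
    (EV : ∀ l : ℕ, (Fin l → V) → (Fin l → ℂ) → VbarT A)
    (EW : ∀ m : ℕ, (Fin m → V) → W → (Fin m → ℂ) → WbarT M)
    {n : ℕ} (m : ℕ) (Φ : Cochain M n) : Prop :=
  (∃ Nb : V → V → ℕ, (∀ a b, 0 < Nb a b) ∧
    ∀ (l : Fin n → ℕ), (∀ i, 0 < l i) → ∀ (hsum : ∑ i, l i = m + n)
      (v : Fin (m + n) → V) (w' : W →ₗ[ℂ] ℂ), GradedFunctionalC M.grading w' →
    ∃ f : (Fin (m + n) → ℂ) → ℂ,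
      RatDiagBnd (m + n) (fun s t => Nb (v s) (v t)) f ∧
      ∀ (ζ : Fin n → ℂ) (z : Fin (m + n) → ℂ),
        (∀ i j : Fin n, i ≠ j → ζ i ≠ ζ j) →
        (∀ i j : Fin n, i ≠ j → ∀ (p : Fin (l i)) (q : Fin (l j)),
          ‖z (blockEmb l hsum i p) - ζ i‖ + ‖z (blockEmb l hsum j q) - ζ j‖
            < ‖ζ i - ζ j‖) →
        (∀ (i : Fin n) (p q : Fin (l i)), p ≠ q →
          z (blockEmb l hsum i p) ≠ z (blockEmb l hsum i q)) →
        HasSum (fun r : Fin n → ℤ =>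
          pairBar w' (Φ (fun i =>
            ((EV (l i) (fun p => v (blockEmb l hsum i p))
              (fun p => z (blockEmb l hsum i p) - ζ i)) (r i) : V)) ζ)) (f z)) ∧
  (∃ Nb : V → V → ℕ, (∀ a b, 0 < Nb a b) ∧
    ∀ (v : Fin (m + n) → V) (w' : W →ₗ[ℂ] ℂ), GradedFunctionalC M.grading w' →
    ∃ f : (Fin (m + n) → ℂ) → ℂ,
      RatDiagBnd (m + n) (fun s t => Nb (v s) (v t)) f ∧
      ∀ z : Fin (m + n) → ℂ, (∀ s t, s ≠ t → z s ≠ z t) →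
        (∀ (i : Fin m) (j : Fin n), ‖z (Fin.castAdd n i)‖ > ‖z (Fin.natAdd m j)‖) →
        (∀ j : Fin n, z (Fin.natAdd m j) ≠ 0) →
        HasSum (fun q : ℂ =>
          pairBar w' (EW m (fun i => v (Fin.castAdd n i))
            ((Φ (fun j => v (Fin.natAdd m j)) (fun j => z (Fin.natAdd m j)) q : W))
            (fun i => z (Fin.castAdd n i)))) (f z))

/-- `Ψ` realizes the composition `Φ ∘ (E^{(l₁)}_{V;𝟏} ⊗ ⋯ ⊗ E^{(lₙ)}_{V;𝟏})`,
defined through the absolutely convergent series of condition 1 of composability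
and rational extension. -/
def IsCompE {A : GRVA V} {M : GRMod V W A}
    (EV : ∀ l : ℕ, (Fin l → V) → (Fin l → ℂ) → VbarT A)
    {n : ℕ} (Φ : Cochain M n) (m' : ℕ) (l : Fin n → ℕ) (hsum : ∑ i, l i = m')
    (Ψ : Cochain M m') : Prop :=
  ∀ (v : Fin m' → V) (w' : W →ₗ[ℂ] ℂ), GradedFunctionalC M.grading w' →
    RatDiag m' (fun z => pairBar w' (Ψ v z)) ∧
    ∀ (ζ : Fin n → ℂ) (z : Fin m' → ℂ),
      (∀ i j : Fin n, i ≠ j → ζ i ≠ ζ j) →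
      (∀ s t : Fin m', s ≠ t → z s ≠ z t) →
      (∀ i j : Fin n, i ≠ j → ∀ (p : Fin (l i)) (q : Fin (l j)),
        ‖z (blockEmb l hsum i p) - ζ i‖ + ‖z (blockEmb l hsum j q) - ζ j‖
          < ‖ζ i - ζ j‖) →
      HasSum (fun r : Fin n → ℤ =>
        pairBar w' (Φ (fun i =>
          ((EV (l i) (fun p => v (blockEmb l hsum i p))
            (fun p => z (blockEmb l hsum i p) - ζ i)) (r i) : V)) ζ))
        (pairBar w' (Ψ v z))

/-- `Ψ` realizes the composition `E^{(p)}_W ∘_{p+1} Φ` (applying `p` module vertex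
operators to the left of the value of `Φ`), defined through the absolutely
convergent series of condition 2 of composability and rational extension. -/
def IsCompW {A : GRVA V} {M : GRMod V W A}
    (EW : ∀ m : ℕ, (Fin m → V) → W → (Fin m → ℂ) → WbarT M)
    {n : ℕ} (Φ : Cochain M n) (p : ℕ) (Ψ : Cochain M (p + n)) : Prop :=
  ∀ (v : Fin (p + n) → V) (w' : W →ₗ[ℂ] ℂ), GradedFunctionalC M.grading w' →
    RatDiag (p + n) (fun z => pairBar w' (Ψ v z)) ∧
    ∀ z : Fin (p + n) → ℂ, (∀ s t, s ≠ t → z s ≠ z t) →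
      (∀ (i : Fin p) (j : Fin n), ‖z (Fin.castAdd n i)‖ > ‖z (Fin.natAdd p j)‖) →
      (∀ j : Fin n, z (Fin.natAdd p j) ≠ 0) →
      HasSum (fun q : ℂ =>
        pairBar w' (EW p (fun i => v (Fin.castAdd n i))
          ((Φ (fun j => v (Fin.natAdd p j)) (fun j => z (Fin.natAdd p j)) q : W))
          (fun i => z (Fin.castAdd n i)))) (pairBar w' (Ψ v z))

/-- `Ψ` realizes the composition `E^{W;(m)}_{WV} ∘₀ Φ` (substituting the value of
`Φ` into the `W`-argument of `E^{W;(m)}_{WV} = E^{W;(1,m)}_{WV}(·)(0, ·)`). -/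
def IsCompWV {A : GRVA V} {M : GRMod V W A}
    (G : ∀ m : ℕ, W → (Fin m → V) → (Fin (m + 1) → ℂ) → WbarT M)
    {n : ℕ} (Φ : Cochain M n) (m : ℕ) (Ψ : Cochain M (n + m)) : Prop :=
  ∀ (v : Fin (n + m) → V) (w' : W →ₗ[ℂ] ℂ), GradedFunctionalC M.grading w' →
    RatDiag (n + m) (fun z => pairBar w' (Ψ v z)) ∧
    ∀ z : Fin (n + m) → ℂ, (∀ s t, s ≠ t → z s ≠ z t) →
      (∀ (j : Fin m) (i : Fin n), ‖z (Fin.natAdd n j)‖ > ‖z (Fin.castAdd m i)‖) →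
      (∀ i : Fin n, z (Fin.castAdd m i) ≠ 0) →
      HasSum (fun q : ℂ =>
        pairBar w' (G m
          ((Φ (fun i => v (Fin.castAdd m i)) (fun i => z (Fin.castAdd m i)) q : W))
          (fun j => v (Fin.natAdd n j))
          (Fin.cons 0 (fun j => z (Fin.natAdd n j)))))
        (pairBar w' (Ψ v z))
/-! ## Shuffles -/

/-- `σ ∈ J_{n;p}`: `σ` preserves the order of the first `p` positions and of the
last `n - p` positions (0-indexed). -/
def IsShuffle {n : ℕ} (p : ℕ) (σ : Equiv.Perm (Fin n)) : Prop :=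
  (∀ s t : Fin n, s < t → (t : ℕ) < p → σ s < σ t) ∧
  (∀ s t : Fin n, s < t → p ≤ (s : ℕ) → σ s < σ t)

/-- The shuffle condition defining the subcomplex `C^n_•(V,W)`: for every
`1 ≤ p ≤ n-1` the signed sum over shuffles of the permuted cochains vanishes
on the configuration space. -/
def ShuffleVanish {A : GRVA V} {M : GRMod V W A} {n : ℕ} (Φ : Cochain M n) : Prop :=
  ∀ p : ℕ, 1 ≤ p → p ≤ n - 1 →
    ∀ (v : Fin n → V) (z : Fin n → ℂ), (∀ s t, s ≠ t → z s ≠ z t) →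
      ∑ σ ∈ Finset.univ.filter (fun σ : Equiv.Perm (Fin n) => IsShuffle p σ),
        ((Equiv.Perm.sign σ : ℤ) : ℂ) • (transport σ Φ) v z = 0

/-! ## The coboundary operator -/

lemma sum_delta_block (n : ℕ) (i : Fin n) :
    ∑ j : Fin n, (if j = i then 2 else 1) = n + 1 := by
  have h : ∀ j : Fin n, (if j = i then 2 else 1) = (if j = i then 1 else 0) + 1 := by
    intro j; split <;> rfl
  simp only [h, Finset.sum_add_distrib, Finset.sum_ite_eq' Finset.univ i (fun _ => 1)]
  simp [Nat.add_comm]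

/-- `Θ` is a realization of the coboundary
`δ̂ⁿ(Φ) = E^{(1)}_W ∘₂ Φ + ∑_{i=1}^n (-1)^i Φ ∘ᵢ E^{(2)}_{V;𝟏}
          + (-1)^{n+1} E^{W;(1)}_{WV} ∘₀ Φ`
on the configuration space, where the three kinds of compositions are encoded by
the predicates `IsCompW`, `IsCompE`, `IsCompWV`. -/
def IsDelta {A : GRVA V} {M : GRMod V W A}
    (EV : ∀ l : ℕ, (Fin l → V) → (Fin l → ℂ) → VbarT A)
    (EW : ∀ m : ℕ, (Fin m → V) → W → (Fin m → ℂ) → WbarT M)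
    (G : ∀ m : ℕ, W → (Fin m → V) → (Fin (m + 1) → ℂ) → WbarT M)
    {n : ℕ} (Φ : Cochain M n) (Θ : Cochain M (n + 1)) : Prop :=
  ∃ (Aw : Cochain M (1 + n)) (B : Fin n → Cochain M (n + 1)) (Cw : Cochain M (n + 1)),
    IsCompW EW Φ 1 Aw ∧
    (∀ i : Fin n, IsCompE EV Φ (n + 1) (fun j => if j = i then 2 else 1)
      (sum_delta_block n i) (B i)) ∧
    IsCompWV G Φ 1 Cw ∧
    (∀ (v : Fin (n + 1) → V) (z : Fin (n + 1) → ℂ), (∀ s t, s ≠ t → z s ≠ z t) →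
      Θ v z = (transport (finCongr (Nat.add_comm 1 n)) Aw) v z
        + (∑ i : Fin n, ((-1 : ℂ) ^ ((i : ℕ) + 1)) • B i) v z
        + (((-1 : ℂ) ^ (n + 1)) • Cw) v z)

/-- Membership in `Ĉⁿₘ(V,W)` (before imposing the shuffle condition):
`W̃`-valued rationality, the `L(-1)`-derivative and `L(0)`-conjugation properties,
and composability with `m` vertex operators. -/
def HatCmem {A : GRVA V} {M : GRMod V W A}
    (EV : ∀ l : ℕ, (Fin l → V) → (Fin l → ℂ) → VbarT A)
    (EW : ∀ m : ℕ, (Fin m → V) → W → (Fin m → ℂ) → WbarT M)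
    {n : ℕ} (m : ℕ) (Φ : Cochain M n) : Prop :=
  TakesRatValues Φ ∧ HasL1D Φ ∧ HasL0conj Φ ∧ Composable EV EW m Φ

/-- Membership in `Cⁿₘ(V,W)`: membership in `Ĉⁿₘ(V,W)` together with the
vanishing of all shuffle sums. -/
def Cmem {A : GRVA V} {M : GRMod V W A}
    (EV : ∀ l : ℕ, (Fin l → V) → (Fin l → ℂ) → VbarT A)
    (EW : ∀ m : ℕ, (Fin m → V) → W → (Fin m → ℂ) → WbarT M)
    {n : ℕ} (m : ℕ) (Φ : Cochain M n) : Prop :=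
  HatCmem EV EW m Φ ∧ ShuffleVanish Φ
/-! ## The extra second coboundary `δ̂²_{1/2}` -/

/-- The data of the two combined absolutely convergent series (and their rational
extensions `f`, `g`) entering the definition of `Ĉ²_{1/2}(V,W)` and of
`δ̂²_{1/2}` for a 2-cochain `Φ`, for fixed `v₁,v₂,v₃` and `w'`. -/
def HalfDeltaData {A : GRVA V} {M : GRMod V W A}
    (EV : ∀ l : ℕ, (Fin l → V) → (Fin l → ℂ) → VbarT A)
    (En1 : ∀ m : ℕ, (Fin m → V) → W → (Fin (m + 1) → ℂ) → WbarT M)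
    (G : ∀ m : ℕ, W → (Fin m → V) → (Fin (m + 1) → ℂ) → WbarT M)
    (Φ : Cochain M 2) (v : Fin 3 → V) (w' : W →ₗ[ℂ] ℂ)
    (f g : (Fin 3 → ℂ) → ℂ) : Prop :=
  RatFull 3 f ∧ RatFull 3 g ∧
  (∀ z₁ z₂ z₃ ζ : ℂ, ‖z₁ - ζ‖ > ‖z₂ - ζ‖ → ‖z₁ - ζ‖ > ‖z₃ - ζ‖ →
      z₂ ≠ ζ → z₃ ≠ ζ → z₂ ≠ z₃ → z₁ ≠ ζ →
    HasSum (fun r : ℂ =>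
      pairBar w' (En1 1 ![v 0] ((Φ ![v 1, v 2] ![z₂ - ζ, z₃ - ζ]) r : W) ![z₁, ζ])
      + pairBar w' (Φ ![v 0, VbarComp (EV 2 ![v 1, v 2] ![z₂ - ζ, z₃ - ζ]) r] ![z₁, ζ]))
      (f ![z₁, z₂, z₃])) ∧
  (∀ z₁ z₂ z₃ ζ : ℂ, ‖ζ - z₃‖ > ‖z₁ - ζ‖ → ‖ζ - z₃‖ > ‖z₂ - ζ‖ →
      z₁ ≠ ζ → z₂ ≠ ζ → z₁ ≠ z₂ → ζ ≠ z₃ →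
    HasSum (fun r : ℂ =>
      pairBar w' (Φ ![VbarComp (EV 2 ![v 0, v 1] ![z₁ - ζ, z₂ - ζ]) r, v 2] ![ζ, z₃])
      + pairBar w' (G 1 ((Φ ![v 0, v 1] ![z₁ - ζ, z₂ - ζ]) r : W) ![v 2] ![ζ, z₃]))
      (g ![z₁, z₂, z₃]))

/-- Membership in `Ĉ²_{1/2}(V,W)`: the two combined series converge absolutely to
rational functions with the only possible poles at `zᵢ = zⱼ` and `zᵢ = 0`. -/
def HalfComposable {A : GRVA V} {M : GRMod V W A}
    (EV : ∀ l : ℕ, (Fin l → V) → (Fin l → ℂ) → VbarT A)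
    (En1 : ∀ m : ℕ, (Fin m → V) → W → (Fin (m + 1) → ℂ) → WbarT M)
    (G : ∀ m : ℕ, W → (Fin m → V) → (Fin (m + 1) → ℂ) → WbarT M)
    (Φ : Cochain M 2) : Prop :=
  ∀ (v : Fin 3 → V) (w' : W →ₗ[ℂ] ℂ), GradedFunctionalC M.grading w' →
    ∃ f g : (Fin 3 → ℂ) → ℂ, HalfDeltaData EV En1 G Φ v w' f g

/-- `Ξ` realizes `δ̂²_{1/2}(Φ)`: the difference of the rational extensions of
the two combined series. -/
def IsDeltaHalf {A : GRVA V} {M : GRMod V W A}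
    (EV : ∀ l : ℕ, (Fin l → V) → (Fin l → ℂ) → VbarT A)
    (En1 : ∀ m : ℕ, (Fin m → V) → W → (Fin (m + 1) → ℂ) → WbarT M)
    (G : ∀ m : ℕ, W → (Fin m → V) → (Fin (m + 1) → ℂ) → WbarT M)
    (Φ : Cochain M 2) (Ξ : Cochain M 3) : Prop :=
  ∀ (v : Fin 3 → V) (w' : W →ₗ[ℂ] ℂ), GradedFunctionalC M.grading w' →
    ∃ f g : (Fin 3 → ℂ) → ℂ, HalfDeltaData EV En1 G Φ v w' f g ∧
      ∀ z : Fin 3 → ℂ, (∀ s t, s ≠ t → z s ≠ z t) →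
        pairBar w' (Ξ v z) = f z - g z

/-! ## Cocycles and coboundaries -/

/-- `Φ ∈ C^n_m(V,W)` is a cocycle: every realization of `δ̂ⁿₘ(Φ)` vanishes on the
configuration space. -/
def IsCocycle {A : GRVA V} {M : GRMod V W A}
    (EV : ∀ l : ℕ, (Fin l → V) → (Fin l → ℂ) → VbarT A)
    (EW : ∀ m : ℕ, (Fin m → V) → W → (Fin m → ℂ) → WbarT M)
    (G : ∀ m : ℕ, W → (Fin m → V) → (Fin (m + 1) → ℂ) → WbarT M)
    {n : ℕ} (m : ℕ) (Φ : Cochain M n) : Prop :=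
  Cmem EV EW m Φ ∧
    ∀ Θ : Cochain M (n + 1), IsDelta EV EW G Φ Θ →
      ∀ (v : Fin (n + 1) → V) (z : Fin (n + 1) → ℂ),
        (∀ s t, s ≠ t → z s ≠ z t) → Θ v z = 0

/-- `Φ` is a coboundary at level `m`: it agrees on the configuration space with a
realization of `δ̂ⁿ_{m+1}(Ψ)` for some `Ψ ∈ Cⁿ_{m+1}(V,W)`. -/
def IsCobound {A : GRVA V} {M : GRMod V W A}
    (EV : ∀ l : ℕ, (Fin l → V) → (Fin l → ℂ) → VbarT A)
    (EW : ∀ m : ℕ, (Fin m → V) → W → (Fin m → ℂ) → WbarT M)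
    (G : ∀ m : ℕ, W → (Fin m → V) → (Fin (m + 1) → ℂ) → WbarT M)
    {n : ℕ} (m : ℕ) (Φ : Cochain M (n + 1)) : Prop :=
  ∃ Ψ : Cochain M n, Cmem EV EW (m + 1) Ψ ∧
    ∃ Θ : Cochain M (n + 1), IsDelta EV EW G Ψ Θ ∧
      ∀ (v : Fin (n + 1) → V) (z : Fin (n + 1) → ℂ),
        (∀ s t, s ≠ t → z s ≠ z t) → Θ v z = Φ v z

/-! ## Uniqueness of character expansions -/

lemma hasSum_of_eq {ι : Type*} {f g : ι → ℂ} {a : ℂ} (h : ∀ i, f i = g i)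
    (hg : HasSum g a) : HasSum f a :=
  (funext h : f = g) ▸ hg

/-- An absolutely convergent expansion in distinct unitary characters of a compact group
that vanishes identically has zero coefficients. -/
lemma eq_zero_of_hasSum_character {G : Type*} [Group G] [TopologicalSpace G]
    [IsTopologicalGroup G] [CompactSpace G] {ι : Type*} [Countable ι] (χ : ι → G →* Circle)
    (hcont : ∀ i, Continuous (χ i)) (hinj : Function.Injective χ) (c : ι → ℂ)
    (h : ∀ g, HasSum (fun i => c i * (χ i g : ℂ)) 0) (j : ι) : c j = 0 := by
  let _ : MeasurableSpace G := borel G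
  have _ : BorelSpace G := ⟨rfl⟩
  let μ : MeasureTheory.Measure G := MeasureTheory.Measure.haarMeasure ⊤
  have _ : MeasureTheory.IsProbabilityMeasure μ :=
    ⟨by simpa using MeasureTheory.Measure.haarMeasure_self (K₀ := (⊤ : TopologicalSpace.PositiveCompacts G))⟩
  have hsum : Summable fun i => ‖c i‖ := by
    simpa using (h 1).summable.norm
  let F : ι → G → ℂ := fun i g => c i * (((χ i g) * (χ j g)⁻¹ : Circle) : ℂ)
  have hFc : ∀ i, Continuous (F i) := fun i => by
    have := hcont i
    have := hcont j
    fun_prop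
  have hint : ∀ i, ∫ g, F i g ∂μ = if i = j then c j else 0 := by
    intro i
    split_ifs with hij
    · subst hij
      simp [F]
    · obtain ⟨g₀, hg₀⟩ : ∃ g, χ i g ≠ χ j g := by
        by_contra! hcon
        exact hij (hinj (MonoidHom.ext hcon))
      have h1 : ∫ g, F i (g₀ * g) ∂μ = ∫ g, F i g ∂μ :=
        MeasureTheory.integral_mul_left_eq_self _ _
      have h2 : ∀ g, F i (g₀ * g) = ((χ i g₀ * (χ j g₀)⁻¹ : Circle) : ℂ) * F i g := by
        intro g
        simp only [F, map_mul, mul_inv, Circle.coe_mul]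
        ring
      simp_rw [h2] at h1
      rw [MeasureTheory.integral_const_mul] at h1
      have h3 : (((χ i g₀ * (χ j g₀)⁻¹ : Circle) : ℂ) - 1) * ∫ g, F i g ∂μ = 0 := by
        rw [sub_mul, h1]; ring
      rcases mul_eq_zero.1 h3 with h4 | h4
      · exfalso
        apply hg₀
        rw [sub_eq_zero, Circle.coe_eq_one] at h4
        exact mul_inv_eq_one.1 h4
      · exact h4
  have hmain := MeasureTheory.hasSum_integral_of_summable_integral_norm (μ := μ) (F := F)
    (fun i => (hFc i).integrable_of_hasCompactSupport
      (HasCompactSupport.of_compactSpace _)) (by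
      simpa only [F, norm_mul, Circle.norm_coe, mul_one, MeasureTheory.integral_const,
        MeasureTheory.probReal_univ, one_smul] using hsum)
  have hzero : ∀ g, ∑' i, F i g = 0 := by
    intro g
    have := (h g).mul_right (((χ j g)⁻¹ : Circle) : ℂ)
    rw [zero_mul] at this
    rw [← this.tsum_eq]
    refine tsum_congr fun i => ?_
    simp only [F, Circle.coe_mul]
    ring
  simp_rw [hzero, hint] at hmain
  have h5 := hmain.unique (hasSum_ite_eq j (c j))
  simpa using h5.symm

/-- The character `u ↦ ∏ uᵢ ^ kᵢ` of the torus. -/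
def torusChar {p : ℕ} (k : Fin p → ℤ) : (Fin p → Circle) →* Circle where
  toFun u := ∏ i, u i ^ k i
  map_one' := by simp
  map_mul' u w := by simp [mul_zpow, Finset.prod_mul_distrib]

lemma torusChar_apply {p : ℕ} (k : Fin p → ℤ) (u : Fin p → Circle) :
    torusChar k u = ∏ i, u i ^ k i := rfl

lemma coe_torusChar {p : ℕ} (k : Fin p → ℤ) (u : Fin p → Circle) :
    (torusChar k u : ℂ) = ∏ i, (u i : ℂ) ^ k i := by
  rw [torusChar_apply]
  exact (map_prod Circle.coeHom _ _).trans (Finset.prod_congr rfl fun i _ => by rw [map_zpow]; rfl)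

lemma torusChar_add {p : ℕ} (k l : Fin p → ℤ) (u : Fin p → Circle) :
    torusChar (k + l) u = torusChar k u * torusChar l u := by
  simp [torusChar_apply, zpow_add, Finset.prod_mul_distrib]

lemma torusChar_neg {p : ℕ} (k : Fin p → ℤ) (u : Fin p → Circle) :
    torusChar (-k) u = (torusChar k u)⁻¹ := by
  simp [torusChar_apply]

lemma torusChar_nsmul {p : ℕ} (n : ℕ) (k : Fin p → ℤ) (u : Fin p → Circle) :
    torusChar (n • k) u = torusChar k u ^ n := by
  simp [torusChar_apply, Finset.prod_pow, mul_comm, zpow_mul]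

lemma torusChar_zero {p : ℕ} (u : Fin p → Circle) : torusChar (0 : Fin p → ℤ) u = 1 := by
  simp [torusChar_apply]

lemma torusChar_single {p : ℕ} (i : Fin p) (u : Fin p → Circle) :
    torusChar (Pi.single i 1) u = u i := by
  rw [torusChar_apply, Finset.prod_eq_single i]
  · simp
  · intro b _ hb
    simp [Pi.single_eq_of_ne hb]
  · simp

lemma torusChar_smul {p : ℕ} (k : Fin p → ℤ) (s : Circle) (u : Fin p → Circle) :
    torusChar k (fun i => s * u i) = s ^ (∑ i, k i) * torusChar k u := by
  have h : ∀ t : Finset (Fin p), ∏ i ∈ t, s ^ k i = s ^ (∑ i ∈ t, k i) := by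
    intro t
    induction t using Finset.induction_on with
    | empty => simp
    | insert a t ha ih => rw [Finset.prod_insert ha, Finset.sum_insert ha, ih, zpow_add]
  simp only [torusChar_apply, mul_zpow, Finset.prod_mul_distrib, h]

lemma continuous_torusChar {p : ℕ} (k : Fin p → ℤ) : Continuous (torusChar k) := by
  change Continuous fun u : Fin p → Circle => ∏ i, u i ^ k i
  exact continuous_finsetProd _ fun i _ => (continuous_apply i).zpow (k i)

lemma zpowGroupHom_circle_injective :
    Function.Injective (fun m : ℤ => (zpowGroupHom m : Circle →* Circle)) := by
  intro m l hml
  by_contra hne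
  have h1 := DFunLike.congr_fun hml (Circle.exp (Real.pi / (m - l : ℤ)))
  have hd : ((m - l : ℤ) : ℝ) ≠ 0 := by exact_mod_cast sub_ne_zero.2 hne
  have h2 : Circle.exp (Real.pi / (m - l : ℤ)) ^ (m - l) = 1 := by
    rw [zpow_sub, mul_inv_eq_one]
    simpa using h1
  rw [← Circle.exp_zsmul, zsmul_eq_mul, mul_div_cancel₀ _ hd] at h2
  have h3 := congrArg (fun x : Circle => (x : ℂ)) h2
  simp at h3
  norm_num at h3

lemma torusChar_injective {p : ℕ} :
    Function.Injective (torusChar : (Fin p → ℤ) → (Fin p → Circle) →* Circle) := by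
  intro k l hkl
  funext i
  apply zpowGroupHom_circle_injective
  ext1 s
  have h : ∀ k : Fin p → ℤ, torusChar k (Pi.mulSingle i s) = s ^ k i := by
    intro k
    rw [torusChar_apply, Finset.prod_eq_single i]
    · simp
    · intro b _ hb
      simp [Pi.mulSingle_eq_of_ne hb]
    · simp
  simpa [h] using DFunLike.congr_fun hkl (Pi.mulSingle i s)

/-- Coefficients of absolutely convergent Fourier expansions on the torus are unique. -/
lemma torus_coeff_unique {p : ℕ} (a b : (Fin p → ℤ) → ℂ) (S : (Fin p → Circle) → ℂ)
    (ha : ∀ u, HasSum (fun k => a k * (torusChar k u : ℂ)) (S u))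
    (hb : ∀ u, HasSum (fun k => b k * (torusChar k u : ℂ)) (S u)) : a = b := by
  funext k
  refine sub_eq_zero.1 (eq_zero_of_hasSum_character torusChar continuous_torusChar
    torusChar_injective (fun k => a k - b k) (fun u => ?_) k)
  simpa [sub_mul] using (ha u).sub (hb u)

/-- Coefficients of absolutely convergent Fourier expansions on the circle are unique. -/
lemma circle_coeff_unique (a b : ℤ → ℂ) (S : Circle → ℂ)
    (ha : ∀ s : Circle, HasSum (fun m => a m * (s : ℂ) ^ m) (S s))
    (hb : ∀ s : Circle, HasSum (fun m => b m * (s : ℂ) ^ m) (S s)) : a = b := by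
  funext m
  refine sub_eq_zero.1 (eq_zero_of_hasSum_character
    (fun m : ℤ => (zpowGroupHom m : Circle →* Circle)) (fun m => continuous_zpow m)
    zpowGroupHom_circle_injective (fun m => a m - b m) (fun s => ?_) m)
  simpa [sub_mul] using (ha s).sub (hb s)

/-- A Fourier series whose sum decomposes into series of pairwise distinct degrees under the
diagonal circle action decomposes coefficientwise. -/
lemma torus_coeff_of_graded {p : ℕ} {ι : Type*} (D : ℤ → ι) (hD : Function.Injective D)
    (a : (Fin p → ℤ) → ℂ) (S : (Fin p → Circle) → ℂ)
    (ha : ∀ u, HasSum (fun k => a k * (torusChar k u : ℂ)) (S u))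
    (b : ι → (Fin p → ℤ) → ℂ) (hdeg : ∀ d k, b d k ≠ 0 → d = D (∑ i, k i))
    (F : ι → (Fin p → Circle) → ℂ)
    (hb : ∀ d u, HasSum (fun k => b d k * (torusChar k u : ℂ)) (F d u))
    (hF : ∀ u, HasSum (fun d => F d u) (S u)) (k : Fin p → ℤ) :
    a k = b (D (∑ i, k i)) k := by
  have hscale : ∀ m u (s : Circle), F (D m) (fun i => s * u i) = F (D m) u * (s : ℂ) ^ m := by
    intro m u s
    refine (hb (D m) _).unique ?_
    refine hasSum_of_eq (fun k => ?_) ((hb (D m) u).mul_right ((s : ℂ) ^ m))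
    by_cases h0 : b (D m) k = 0
    · simp [h0]
    · rw [torusChar_smul, ← hD (hdeg _ _ h0)]
      push_cast
      ring
  have hout : ∀ d u, d ∉ Set.range D → F d u = 0 := by
    intro d u hd
    refine (hb d u).unique ?_
    refine hasSum_of_eq (fun k => ?_) hasSum_zero
    have h0 : b d k = 0 := by
      by_contra h0
      exact hd ⟨_, (hdeg _ _ h0).symm⟩
    simp [h0]
  have hgr : ∀ u m, ∑' x : (fun k : Fin p → ℤ => ∑ i, k i) ⁻¹' {m},
      a x * (torusChar x.1 u : ℂ) = F (D m) u := by
    intro u m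
    refine congrFun (circle_coeff_unique
      (fun m => ∑' x : (fun k : Fin p → ℤ => ∑ i, k i) ⁻¹' {m}, a x * (torusChar x.1 u : ℂ))
      (fun m => F (D m) u) (fun s => S (fun i => s * u i)) (fun s => ?_) (fun s => ?_)) m
    · refine hasSum_of_eq (fun m => ?_)
        ((ha (fun i => s * u i)).tsum_fiberwise (fun k : Fin p → ℤ => ∑ i, k i))
      rw [← tsum_mul_right]
      refine tsum_congr fun x => ?_
      have hx : ∑ i, x.1 i = m := x.2
      rw [torusChar_smul, hx]
      push_cast
      ring
    · have h1 := hF (fun i => s * u i)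
      rw [← hD.hasSum_iff (fun d hd => hout d _ hd)] at h1
      refine hasSum_of_eq (fun m => ?_) h1
      exact (hscale m u s).symm
  have key := torus_coeff_unique
    (fun l => if ∑ i, l i = ∑ i, k i then a l else 0) (b (D (∑ i, k i)))
    (F (D (∑ i, k i))) (fun u => ?_) (hb _)
  · simpa using congrFun key k
  · rw [← hgr u]
    have h2 : Summable fun x : (fun l : Fin p → ℤ => ∑ i, l i) ⁻¹' {∑ i, k i} =>
        a x * (torusChar x.1 u : ℂ) := (ha u).summable.subtype _
    have h3 := (hasSum_subtype_iff_indicator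
      (f := fun l : Fin p → ℤ => a l * (torusChar l u : ℂ))).1 h2.hasSum
    refine hasSum_of_eq (fun l => ?_) h3
    by_cases hl : ∑ i, l i = ∑ i, k i
    · simp [Set.indicator, hl]
    · simp [Set.indicator, hl]

/-! ## Torus expansions of rational functions -/

/-- A function on the torus with an absolutely convergent expansion in characters. -/
def TorusExpandable {p : ℕ} (f : (Fin p → Circle) → ℂ) : Prop :=
  ∃ (ι : Type) (a : ι → ℂ) (deg : ι → Fin p → ℤ),
    ∀ u, HasSum (fun i => a i * (torusChar (deg i) u : ℂ)) (f u)

namespace TorusExpandable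

variable {p : ℕ} {f g : (Fin p → Circle) → ℂ}

lemma monomial (c : ℂ) (k : Fin p → ℤ) :
    TorusExpandable (fun u => c * (torusChar k u : ℂ)) :=
  ⟨Unit, fun _ => c, fun _ => k, fun u => hasSum_unique fun _ : Unit => c * (torusChar k u : ℂ)⟩

lemma const (c : ℂ) : TorusExpandable (fun _ : Fin p → Circle => c) := by
  simpa [torusChar_zero] using monomial (p := p) c 0

lemma add (hf : TorusExpandable f) (hg : TorusExpandable g) :
    TorusExpandable (fun u => f u + g u) := by
  obtain ⟨ι, a, d, h⟩ := hf
  obtain ⟨κ, b, e, h'⟩ := hg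
  exact ⟨ι ⊕ κ, Sum.elim a b, Sum.elim d e, fun u => HasSum.sum (h u) (h' u)⟩

lemma mul (hf : TorusExpandable f) (hg : TorusExpandable g) :
    TorusExpandable (fun u => f u * g u) := by
  obtain ⟨ι, a, d, h⟩ := hf
  obtain ⟨κ, b, e, h'⟩ := hg
  refine ⟨ι × κ, fun x => a x.1 * b x.2, fun x => d x.1 + e x.2, fun u => ?_⟩
  have hs : Summable fun x : ι × κ =>
      (a x.1 * (torusChar (d x.1) u : ℂ)) * (b x.2 * (torusChar (e x.2) u : ℂ)) :=
    summable_mul_of_summable_norm (f := fun i => a i * (torusChar (d i) u : ℂ))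
      (g := fun j => b j * (torusChar (e j) u : ℂ)) (h u).summable.norm (h' u).summable.norm
  have hm := (h u).mul (h' u) hs
  refine hasSum_of_eq (fun x => ?_) hm
  rw [torusChar_add, Circle.coe_mul]
  ring

lemma pow (hf : TorusExpandable f) (n : ℕ) : TorusExpandable (fun u => f u ^ n) := by
  induction n with
  | zero => simpa using const 1
  | succ n ih => simpa only [pow_succ] using ih.mul hf

lemma prod {ι : Type*} (s : Finset ι) {F : ι → (Fin p → Circle) → ℂ}
    (h : ∀ i ∈ s, TorusExpandable (F i)) : TorusExpandable (fun u => ∏ i ∈ s, F i u) := by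
  induction s using Finset.induction_on with
  | empty => simpa using const 1
  | insert a t ha ih =>
    simp only [Finset.prod_insert ha]
    exact (h a (Finset.mem_insert_self a t)).mul
      (ih fun i hi => h i (Finset.mem_insert_of_mem hi))

lemma eval {N : ℕ} (P : MvPolynomial (Fin N) ℂ) {F : (Fin p → Circle) → Fin N → ℂ}
    (hF : ∀ i, TorusExpandable (fun u => F u i)) :
    TorusExpandable (fun u => MvPolynomial.eval (F u) P) := by
  induction P using MvPolynomial.induction_on with
  | C a => simpa using const a
  | add P Q hP hQ => simpa using hP.add hQ
  | mul_X P i hP => simpa using hP.mul (hF i)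

lemma inv_sub (k l : Fin p → ℤ) {x y : ℂ} (hxy : ‖y‖ < ‖x‖) :
    TorusExpandable (fun u => ((torusChar k u : ℂ) * x - (torusChar l u : ℂ) * y)⁻¹) := by
  have hx : x ≠ 0 := norm_pos_iff.1 ((norm_nonneg y).trans_lt hxy)
  refine ⟨ℕ, fun n => x⁻¹ * (y / x) ^ n, fun n => n • (l - k) + -k, fun u => ?_⟩
  have hk : (torusChar k u : ℂ) ≠ 0 := Circle.coe_ne_zero _
  have hr : ‖(torusChar l u : ℂ) * y / ((torusChar k u : ℂ) * x)‖ < 1 := by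
    rw [norm_div, norm_mul, norm_mul, Circle.norm_coe, Circle.norm_coe, one_mul, one_mul,
      div_lt_one (norm_pos_iff.2 hx)]
    exact hxy
  have hne : (1 : ℂ) - (torusChar l u : ℂ) * y / ((torusChar k u : ℂ) * x) ≠ 0 := by
    intro h0
    rw [← sub_eq_zero.1 h0] at hr
    simp at hr
  have hval : ((torusChar k u : ℂ) * x - (torusChar l u : ℂ) * y)⁻¹ =
      ((torusChar k u : ℂ) * x)⁻¹ *
        (1 - (torusChar l u : ℂ) * y / ((torusChar k u : ℂ) * x))⁻¹ := by
    rw [← mul_inv]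
    congr 1
    field_simp
  beta_reduce
  rw [hval]
  refine hasSum_of_eq (fun n => ?_) ((hasSum_geometric_of_norm_lt_one hr).mul_left _)
  rw [torusChar_add, torusChar_nsmul, sub_eq_add_neg, torusChar_add, torusChar_neg]
  push_cast
  simp only [div_eq_mul_inv, mul_pow, mul_inv]
  ring

lemma exists_coeff (hf : TorusExpandable f) :
    ∃ a : (Fin p → ℤ) → ℂ, ∀ u, HasSum (fun k => a k * (torusChar k u : ℂ)) (f u) := by
  obtain ⟨ι, a, d, h⟩ := hf
  refine ⟨fun k => ∑' i : d ⁻¹' {k}, a i, fun u => ?_⟩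
  refine hasSum_of_eq (fun k => ?_) ((h u).tsum_fiberwise d)
  rw [← tsum_mul_right]
  refine tsum_congr fun i => ?_
  have hi : d i.1 = k := i.2
  rw [hi]

end TorusExpandable

lemma RatDiag.torusExpandable {N p : ℕ} {f : (Fin N → ℂ) → ℂ} (hf : RatDiag N f)
    (χ : Fin N → Fin p → ℤ) {z : Fin N → ℂ} (hz : ∀ i j, i < j → ‖z j‖ < ‖z i‖) :
    TorusExpandable (fun u => f (fun i => (torusChar (χ i) u : ℂ) * z i)) := by
  obtain ⟨P, n, hP⟩ := hf
  have hne : ∀ u : Fin p → Circle, ∀ i j, i < j →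
      (torusChar (χ i) u : ℂ) * z i ≠ (torusChar (χ j) u : ℂ) * z j := by
    intro u i j hij h
    have := congrArg norm h
    simp only [norm_mul, Circle.norm_coe, one_mul] at this
    exact (hz i j hij).ne' this
  have hform : (fun u : Fin p → Circle => f (fun i => (torusChar (χ i) u : ℂ) * z i)) =
      fun u => MvPolynomial.eval (fun i => (torusChar (χ i) u : ℂ) * z i) P *
        ∏ i : Fin N, ∏ j : Fin N, (if i < j then
          (((torusChar (χ i) u : ℂ) * z i - (torusChar (χ j) u : ℂ) * z j)⁻¹) ^ n else 1) := by
    funext u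
    have h1 := hP (fun i => (torusChar (χ i) u : ℂ) * z i) (fun i j hij =>
      (lt_or_gt_of_ne hij).elim (hne u i j) fun h => (hne u j i h).symm)
    rw [← h1, mul_assoc, ← Finset.prod_mul_distrib, Finset.prod_eq_one, mul_one]
    intro i _
    rw [← Finset.prod_mul_distrib, Finset.prod_eq_one]
    intro j _
    split_ifs with hij
    · rw [← mul_pow, mul_inv_cancel₀ (sub_ne_zero.2 (hne u i j hij)), one_pow]
    · simp
  rw [hform]
  refine (TorusExpandable.eval P fun i => ?_).mul
    (TorusExpandable.prod _ fun i _ => TorusExpandable.prod _ fun j _ => ?_)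
  · simpa only [mul_comm] using TorusExpandable.monomial (z i) (χ i)
  · by_cases hij : i < j
    · simpa only [hij, if_true] using (TorusExpandable.inv_sub (χ i) (χ j) (hz i j hij)).pow n
    · simpa only [hij, if_false] using TorusExpandable.const 1

/-- Rational functions with poles on the diagonals are determined by their values on the
region `|z₁| > ⋯ > |z_N| > 0`. -/
lemma RatDiag.eq_of_ordered {N : ℕ} {f g : (Fin N → ℂ) → ℂ} (hf : RatDiag N f)
    (hg : RatDiag N g)
    (h : ∀ z : Fin N → ℂ, (∀ i j, i < j → ‖z j‖ < ‖z i‖) → (∀ i, z i ≠ 0) → f z = g z)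
    (z : Fin N → ℂ) (hz : ∀ i j, i ≠ j → z i ≠ z j) : f z = g z := by
  obtain ⟨P, n, hP⟩ := hf
  obtain ⟨Q, m, hQ⟩ := hg
  let D : ℕ → MvPolynomial (Fin N) ℂ := fun n => ∏ i : Fin N, ∏ j : Fin N,
    (if i < j then (MvPolynomial.X i - MvPolynomial.X j) ^ n else 1)
  have hD : ∀ n w, MvPolynomial.eval w (D n) =
      ∏ i : Fin N, ∏ j : Fin N, (if i < j then (w i - w j) ^ n else 1) := by
    intro n w
    simp only [D, map_prod]
    refine Finset.prod_congr rfl fun i _ => Finset.prod_congr rfl fun j _ => ?_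
    split_ifs <;> simp
  have hD0 : ∀ n, MvPolynomial.eval z (D n) ≠ 0 := by
    intro n
    rw [hD]
    refine Finset.prod_ne_zero_iff.2 fun i _ => Finset.prod_ne_zero_iff.2 fun j _ => ?_
    split_ifs with hij
    · exact pow_ne_zero _ (sub_ne_zero.2 (hz i j hij.ne))
    · exact one_ne_zero
  simp only [← hD] at hP hQ
  have key : P * D m = Q * D n := by
    refine MvPolynomial.funext_set
      (fun i : Fin N => (fun x : ℝ => (x : ℂ)) '' Set.Ioo ((N : ℝ) - i) (N - i + 1))
      (fun i => (Set.Ioo_infinite (by linarith)).image Complex.ofReal_injective.injOn)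
      fun w hw => ?_
    have hw' : ∀ i : Fin N, (N : ℝ) - i < ‖w i‖ ∧ ‖w i‖ < N - i + 1 := by
      intro i
      obtain ⟨x, hx, hxw⟩ := hw i (Set.mem_univ i)
      have hi : ((i : ℕ) : ℝ) < N := by exact_mod_cast i.2
      have hx0 : 0 < x := by linarith [hx.1]
      rw [← hxw]
      simp only [Complex.norm_real, Real.norm_eq_abs, abs_of_pos hx0]
      exact hx
    have hord : ∀ i j, i < j → ‖w j‖ < ‖w i‖ := by
      intro i j hij
      have h1 : ((i : ℕ) : ℝ) + 1 ≤ (j : ℕ) := by exact_mod_cast hij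
      linarith [(hw' i).1, (hw' j).2]
    have hne : ∀ i j, i ≠ j → w i ≠ w j := by
      intro i j hij h0
      rcases lt_or_gt_of_ne hij with h1 | h1
      · exact (hord i j h1).ne (by rw [h0])
      · exact (hord j i h1).ne (by rw [h0])
    have hw0 : ∀ i, w i ≠ 0 := by
      intro i
      have hi : ((i : ℕ) : ℝ) < N := by exact_mod_cast i.2
      exact norm_pos_iff.1 (by linarith [(hw' i).1])
    rw [map_mul, map_mul, ← hP w hne, ← hQ w hne, h w hord hw0]
    ring
  have h2 := congrArg (MvPolynomial.eval z) key
  rw [map_mul, map_mul, ← hP z hz, ← hQ z hz] at h2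
  refine mul_right_cancel₀ (mul_ne_zero (hD0 n) (hD0 m)) ?_
  linear_combination h2

/-! ## Modes of module vertex operators and weights -/

lemma GRMod.mem_grading_of_pow_eq_zero {A : GRVA V} (M : GRMod V W A) {c : ℂ} {x : W} {K : ℕ}
    (h : ((M.L0 - c • 1) ^ K) x = 0) : x ∈ M.grading c := by
  let := M.decomp
  have hle : ∀ e, M.grading e ≤ M.L0.maxGenEigenspace e := fun e w hw =>
    (Module.End.mem_maxGenEigenspace M.L0 e w).2 (M.L0_nilpotent e w hw)
  have hx : x ∈ M.L0.maxGenEigenspace c := (Module.End.mem_maxGenEigenspace M.L0 c x).2 ⟨K, h⟩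
  set y : W := (DirectSum.decompose M.grading x c : W) with hy
  have hyc : y ∈ M.grading c := (DirectSum.decompose M.grading x c).2
  have hxy : x - y ∈ ⨆ e, ⨆ (_ : e ≠ c), M.L0.maxGenEigenspace e := by
    have hsub : x - y = ∑ e ∈ ((DirectSum.decompose M.grading x).support.erase c),
        (DirectSum.decompose M.grading x e : W) := by
      rw [sub_eq_iff_eq_add]
      by_cases hc : c ∈ (DirectSum.decompose M.grading x).support
      · rw [Finset.sum_erase_add _ _ hc, DirectSum.sum_support_decompose]
      · have h0 : y = 0 := by simpa [hy] using hc
        rw [Finset.erase_eq_of_notMem hc, h0, add_zero, DirectSum.sum_support_decompose]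
    rw [hsub]
    refine Submodule.sum_mem _ fun e he => ?_
    exact Submodule.mem_iSup_of_mem e (Submodule.mem_iSup_of_mem (Finset.ne_of_mem_erase he)
      (hle e (DirectSum.decompose M.grading x e).2))
  have h0 : x - y = 0 := Submodule.disjoint_def.1 (M.L0.independent_maxGenEigenspace c) _
    (Submodule.sub_mem _ hx (hle c hyc)) hxy
  rw [sub_eq_zero.1 h0]
  exact hyc

/-- The coefficient `(Y)_k(u)` of a vertex operator, as a linear operator. -/
def vertexMode {X : Type} [AddCommGroup X] [Module ℂ X]
    (Yop : V →ₗ[ℂ] X →ₗ[ℂ] (ℤ → X)) (u : V) (k : ℤ) : Module.End ℂ X :=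
  LinearMap.proj k ∘ₗ Yop u

/-- The product of the modes `(Y)_{k i}(v i)`, in increasing order of `i`. -/
def vertexWord {X : Type} [AddCommGroup X] [Module ℂ X] {n : ℕ}
    (Yop : V →ₗ[ℂ] X →ₗ[ℂ] (ℤ → X)) (v : Fin n → V) (k : Fin n → ℤ) : Module.End ℂ X :=
  (List.ofFn fun i => vertexMode Yop (v i) (k i)).prod

lemma applyList_finRange {X : Type} [AddCommGroup X] [Module ℂ X] {n : ℕ}
    (Yop : V →ₗ[ℂ] X →ₗ[ℂ] (ℤ → X)) (v : Fin n → V) (k : Fin n → ℤ) (w : X) :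
    applyList Yop v k (List.finRange n) w = vertexWord Yop v k w := by
  have h : ∀ L : List (Fin n), applyList Yop v k L w =
      (L.map fun i => vertexMode Yop (v i) (k i)).prod w := by
    intro L
    induction L with
    | nil => rfl
    | cons t ts ih =>
      rw [List.map_cons, List.prod_cons, Module.End.mul_apply, ← ih]
      rfl
  rw [h, vertexWord, List.ofFn_eq_map]

lemma vertexWord_append {X : Type} [AddCommGroup X] [Module ℂ X] {p q : ℕ}
    (Yop : V →ₗ[ℂ] X →ₗ[ℂ] (ℤ → X)) (v : Fin (p + q) → V) (k : Fin p → ℤ) (l : Fin q → ℤ) :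
    vertexWord Yop v (Fin.append k l) =
      vertexWord Yop (fun i => v (Fin.castAdd q i)) k *
        vertexWord Yop (fun i => v (Fin.natAdd p i)) l := by
  rw [vertexWord, List.ofFn_add, List.prod_append]
  congr 1
  · refine congrArg (fun f => (List.ofFn f).prod) (funext fun i => ?_)
    change vertexMode Yop _ (Fin.append k l (Fin.castAdd q i)) = _
    rw [Fin.append_left]
    rfl
  · refine congrArg (fun f => (List.ofFn f).prod) (funext fun i => ?_)
    rw [Fin.append_right]

lemma GRMod.L0_sub_pow_mode {A : GRVA V} (M : GRMod V W A) {u : V} {h : ℤ}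
    (hu : u ∈ A.grading h) (c : ℂ) (k : ℤ) (K : ℕ) (w : W) :
    ((M.L0 - (c + (h - k - 1 : ℤ)) • 1) ^ K) (M.Y u w k) =
      M.Y u (((M.L0 - c • 1) ^ K) w) k := by
  induction K generalizing w with
  | zero => simp
  | succ K ih =>
    rw [pow_succ, pow_succ, Module.End.mul_apply, Module.End.mul_apply, ← ih]
    congr 1
    simp only [LinearMap.sub_apply, LinearMap.smul_apply, Module.End.one_apply, M.L0_bracket,
      A.L0_eq h u hu, map_smul, map_sub, Pi.smul_apply, Pi.sub_apply]
    push_cast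
    module

lemma GRMod.vertexMode_mem {A : GRVA V} (M : GRMod V W A) {u : V} {h : ℤ}
    (hu : u ∈ A.grading h) {c : ℂ} {w : W} (hw : w ∈ M.grading c) (k : ℤ) :
    vertexMode M.Y u k w ∈ M.grading (c + (h - k - 1 : ℤ)) := by
  obtain ⟨K, hK⟩ := M.L0_nilpotent c w hw
  refine M.mem_grading_of_pow_eq_zero (K := K) ?_
  change ((M.L0 - (c + (h - k - 1 : ℤ)) • 1) ^ K) (M.Y u w k) = 0
  rw [M.L0_sub_pow_mode hu, hK, map_zero, Pi.zero_apply]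

lemma GRMod.vertexWord_mem {A : GRVA V} (M : GRMod V W A) {p : ℕ} {v : Fin p → V}
    {wt : Fin p → ℤ} (hv : ∀ i, v i ∈ A.grading (wt i)) {c : ℂ} {w : W}
    (hw : w ∈ M.grading c) (k : Fin p → ℤ) :
    vertexWord M.Y v k w ∈ M.grading (c + (∑ i, (wt i - k i - 1) : ℤ)) := by
  induction p with
  | zero => simpa [vertexWord] using hw
  | succ p ih =>
    have h1 := ih (fun i => hv i.succ) (fun i => k i.succ)
    have h2 := M.vertexMode_mem (hv 0) h1 (k 0)
    rw [vertexWord, List.ofFn_succ, List.prod_cons, Module.End.mul_apply, Fin.sum_univ_succ]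
    have h3 : c + ((wt 0 - k 0 - 1 + ∑ i : Fin p, (wt i.succ - k i.succ - 1) : ℤ) : ℂ) =
        c + (∑ i : Fin p, (wt i.succ - k i.succ - 1) : ℤ) + (wt 0 - k 0 - 1 : ℤ) := by
      push_cast
      ring
    rw [h3]
    exact h2

/-- A functional vanishing on all homogeneous subspaces except the one of weight `c`. -/
def SupportedAt {A : GRVA V} (M : GRMod V W A) (c : ℂ) (w' : W →ₗ[ℂ] ℂ) : Prop :=
  ∀ e, ∀ w ∈ M.grading e, w' w ≠ 0 → e = c

namespace SupportedAt

variable {A : GRVA V} {M : GRMod V W A} {c : ℂ} {w' : W →ₗ[ℂ] ℂ}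

lemma gradedFunctionalC (h : SupportedAt M c w') : GradedFunctionalC M.grading w' :=
  (Set.finite_singleton c).subset fun e he => by
    obtain ⟨w, hw, hne⟩ := he
    exact h e w hw hne

lemma pairBar_eq (h : SupportedAt M c w') (ω : WbarT M) : pairBar w' ω = w' (ω c) :=
  finsum_eq_single _ c fun e he => by
    by_contra hne
    exact he (h e _ (ω e).2 hne)

lemma comp_vertexWord (h : SupportedAt M c w') {p : ℕ} {v : Fin p → V} {wt : Fin p → ℤ}
    (hv : ∀ i, v i ∈ A.grading (wt i)) (k : Fin p → ℤ) :
    SupportedAt M (c - (∑ i, (wt i - k i - 1) : ℤ)) (w' ∘ₗ vertexWord M.Y v k) :=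
  fun _ _ hw hne => eq_sub_of_add_eq (h _ _ (M.vertexWord_mem hv hw k) hne)

end SupportedAt

lemma IsEWFam.hasSum_vertexWord {A : GRVA V} {M : GRMod V W A}
    {EW : ∀ m : ℕ, (Fin m → V) → W → (Fin m → ℂ) → WbarT M} (hEW : IsEWFam M EW) {p : ℕ}
    (v : Fin p → V) (w : W) {w' : W →ₗ[ℂ] ℂ} (hw' : GradedFunctionalC M.grading w')
    {z : Fin p → ℂ} (hz : ∀ i j, i < j → ‖z j‖ < ‖z i‖) (hz0 : ∀ i, z i ≠ 0) :
    HasSum (fun k : Fin p → ℤ => w' (vertexWord M.Y v k w) * ∏ i, z i ^ (-k i - 1))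
      (pairBar w' (EW p v w z)) := by
  obtain ⟨f, -, hf, hpair⟩ := hEW p v w w' hw'
  have hne : ∀ s t, s ≠ t → z s ≠ z t := by
    intro s t hst h0
    rcases lt_or_gt_of_ne hst with h1 | h1
    · exact (hz s t h1).ne (by rw [h0])
    · exact (hz t s h1).ne (by rw [h0])
  rw [hpair z hne hz0]
  have hchain : (List.finRange p).IsChain (fun s t => ‖z s‖ > ‖z t‖) :=
    ((List.pairwise_lt_finRange p).imp fun {s t} hst => hz s t hst).isChain
  exact hasSum_of_eq (fun k => by rw [applyList_finRange]) (hf z hchain hz0)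

/-- The pairing with a composition `E^{(p)}_W ∘ Φ` is expanded in the modes of the `p` vertex
operators. -/
lemma IsCompW.hasSum_vertexWord {A : GRVA V} {M : GRMod V W A}
    {EW : ∀ m : ℕ, (Fin m → V) → W → (Fin m → ℂ) → WbarT M} (hEW : IsEWFam M EW) {n p : ℕ}
    {Φ : Cochain M n} {Ψ : Cochain M (p + n)} (h : IsCompW EW Φ p Ψ)
    {v : Fin (p + n) → V} {wt : Fin p → ℤ}
    (hv : ∀ i, v (Fin.castAdd n i) ∈ A.grading (wt i))
    {c : ℂ} {w' : W →ₗ[ℂ] ℂ} (hw' : SupportedAt M c w')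
    {z : Fin (p + n) → ℂ} (hz : ∀ i j, i < j → ‖z j‖ < ‖z i‖) (hz0 : ∀ i, z i ≠ 0) :
    HasSum (fun k : Fin p → ℤ =>
      pairBar (w' ∘ₗ vertexWord M.Y (fun i => v (Fin.castAdd n i)) k)
        (Φ (fun j => v (Fin.natAdd p j)) (fun j => z (Fin.natAdd p j))) *
          ∏ i, z (Fin.castAdd n i) ^ (-k i - 1))
      (pairBar w' (Ψ v z)) := by
  obtain ⟨hrat, hsum⟩ := h v w' hw'.gradedFunctionalC
  let χ : Fin (p + n) → Fin p → ℤ := Fin.append (fun i => Pi.single i 1) (fun _ => 0)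
  have hχl : ∀ i u, torusChar (χ (Fin.castAdd n i)) u = u i := fun i u => by
    simp only [χ, Fin.append_left, torusChar_single]
  have hχr : ∀ j u, torusChar (χ (Fin.natAdd p j)) u = 1 := fun j u => by
    simp only [χ, Fin.append_right]
    exact torusChar_zero u
  obtain ⟨a, ha⟩ := (hrat.torusExpandable χ hz).exists_coeff
  set y : (Fin p → Circle) → Fin (p + n) → ℂ := fun u i => (torusChar (χ i) u : ℂ) * z i with hy
  have hyl : ∀ u i, y u (Fin.castAdd n i) = u i * z (Fin.castAdd n i) := fun u i => by
    simp only [hy, hχl]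
  have hyr : ∀ u j, y u (Fin.natAdd p j) = z (Fin.natAdd p j) := fun u j => by
    simp only [hy, hχr, Circle.coe_one, one_mul]
  have hnorm : ∀ u i, ‖y u i‖ = ‖z i‖ := fun u i => by
    simp only [hy, norm_mul, Circle.norm_coe, one_mul]
  have hy0 : ∀ u i, y u i ≠ 0 := fun u i => by
    rw [← norm_pos_iff, hnorm]
    exact norm_pos_iff.2 (hz0 i)
  have hyz : ∀ u i j, i < j → ‖y u j‖ < ‖y u i‖ := fun u i j hij => by
    rw [hnorm, hnorm]
    exact hz i j hij
  have hyne : ∀ u i j, i ≠ j → y u i ≠ y u j := by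
    intro u i j hij h0
    rcases lt_or_gt_of_ne hij with h1 | h1
    · exact (hyz u i j h1).ne (by rw [h0])
    · exact (hyz u j i h1).ne (by rw [h0])
  let vl : Fin p → V := fun i => v (Fin.castAdd n i)
  let zl : Fin p → ℂ := fun i => z (Fin.castAdd n i)
  let ω : WbarT M := Φ (fun j => v (Fin.natAdd p j)) (fun j => z (Fin.natAdd p j))
  let F : ℂ → (Fin p → Circle) → ℂ := fun d u =>
    pairBar w' (EW p vl (ω d) (fun i => y u (Fin.castAdd n i)))
  let e : (Fin p → ℤ) ≃ (Fin p → ℤ) := Equiv.piCongrRight fun _ => Equiv.subLeft (-1)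
  have he : ∀ k i, -(e k i) - 1 = k i := fun k i => by
    change -(-1 - k i) - 1 = k i
    ring
  have hek : ∀ k i, e k i = -k i - 1 := fun k i => by
    change -1 - k i = -k i - 1
    ring
  let b : ℂ → (Fin p → ℤ) → ℂ := fun d k =>
    w' (vertexWord M.Y vl (e k) (ω d)) * ∏ i, zl i ^ k i
  have hdeg : ∀ d k, b d k ≠ 0 →
      d = (fun m : ℤ => c - (∑ i, wt i : ℤ) - m) (∑ i, k i) := by
    intro d k hdk
    have h1 := hw' _ _ (M.vertexWord_mem hv (ω d).2 (e k)) (left_ne_zero_of_mul hdk)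
    have h2 : ∀ i, wt i - e k i - 1 = wt i + k i := fun i => by rw [hek]; ring
    simp only [h2, Finset.sum_add_distrib] at h1
    rw [← h1]
    push_cast
    ring
  have hb : ∀ d u, HasSum (fun k => b d k * (torusChar k u : ℂ)) (F d u) := by
    intro d u
    have h1 := hEW.hasSum_vertexWord vl (ω d : W) hw'.gradedFunctionalC
      (z := fun i => y u (Fin.castAdd n i))
      (fun i j hij => hyz u _ _ hij) (fun i => hy0 u _)
    rw [← e.hasSum_iff] at h1
    refine hasSum_of_eq (fun k => ?_) h1
    simp only [Function.comp_apply, he, hyl, mul_zpow, Finset.prod_mul_distrib, coe_torusChar,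
      b, zl]
    ring
  have hF : ∀ u, HasSum (fun d => F d u) (pairBar w' (Ψ v (y u))) := by
    intro u
    have h1 := hsum (y u) (hyne u)
      (fun i j => hyz u _ _ (by
        rw [Fin.lt_def, Fin.val_castAdd, Fin.val_natAdd]
        omega))
      (fun j => hy0 u _)
    simp only [hyr] at h1
    exact h1
  have hcoeff := torus_coeff_of_graded _
    (fun m l hml => Int.cast_injective (sub_right_injective hml)) a _ ha b hdeg F hb hF
  have h1 := ha 1
  simp only [map_one, Circle.coe_one, one_mul, mul_one] at h1
  rw [← e.symm.hasSum_iff] at h1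
  refine hasSum_of_eq (fun k => ?_) h1
  obtain ⟨k, rfl⟩ := e.surjective k
  rw [Function.comp_apply, e.symm_apply_apply, hcoeff, (hw'.comp_vertexWord hv _).pairBar_eq]
  simp only [he, b]
  have h2 : c - (∑ i, (wt i - e k i - 1) : ℤ) = c - (∑ i, wt i : ℤ) - (∑ i, k i : ℤ) := by
    have h2 : ∀ i, wt i - e k i - 1 = wt i + k i := fun i => by rw [hek]; ring
    simp only [h2, Finset.sum_add_distrib]
    push_cast
    ring
  rw [h2]
  rfl

lemma WbarT.ext_pairBar {A : GRVA V} {M : GRMod V W A} {ω₁ ω₂ : WbarT M}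
    (h : ∀ c w', SupportedAt M c w' → pairBar w' ω₁ = pairBar w' ω₂) : ω₁ = ω₂ := by
  let := M.decomp
  funext c
  refine Subtype.ext (sub_eq_zero.1 ((Module.forall_dual_apply_eq_zero_iff ℂ _).1 fun f => ?_))
  let w' : W →ₗ[ℂ] ℂ := f ∘ₗ (M.grading c).subtype ∘ₗ
    DirectSum.component ℂ ℂ (fun e => M.grading e) c ∘ₗ
      (DirectSum.decomposeLinearEquiv M.grading).toLinearMap
  have hval : ∀ w, w' w = f (DirectSum.decompose M.grading w c : W) := fun _ => rfl
  have hw' : SupportedAt M c w' := by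
    intro e w hw hne
    by_contra hec
    rw [hval, DirectSum.decompose_of_mem_ne M.grading hw hec, map_zero] at hne
    exact hne rfl
  have h1 := h c w' hw'
  rw [hw'.pairBar_eq, hw'.pairBar_eq, hval, hval, DirectSum.decompose_of_mem_same _ (ω₁ c).2,
    DirectSum.decompose_of_mem_same _ (ω₂ c).2] at h1
  rw [map_sub, h1, sub_self]

lemma GRVA.span_homogeneous (A : GRVA V) :
    Submodule.span ℂ {u : V | ∃ k, u ∈ A.grading k} = ⊤ := by
  let := A.decomp
  refine eq_top_iff.2 fun u _ => ?_
  rw [← DirectSum.sum_support_decompose A.grading u]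
  exact Submodule.sum_mem _ fun k _ => Submodule.subset_span ⟨k, SetLike.coe_mem _⟩

lemma RatDiag.comp_cast {N N' : ℕ} (e : N = N') {f : (Fin N → ℂ) → ℂ} (hf : RatDiag N f) :
    RatDiag N' (fun z => f (fun j => z (Fin.cast e j))) := by
  subst e
  exact hf

lemma IsCompW.pairBar_eq_of_ordered {A : GRVA V} {M : GRMod V W A}
    {EW : ∀ m : ℕ, (Fin m → V) → W → (Fin m → ℂ) → WbarT M} (hEW : IsEWFam M EW) {n p q : ℕ}
    {Φ : Cochain M n} {Ψ₁ : Cochain M (q + n)} (h₁ : IsCompW EW Φ q Ψ₁)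
    {Ψ₂ : Cochain M (p + (q + n))} (h₂ : IsCompW EW Ψ₁ p Ψ₂)
    {Ψ₃ : Cochain M (p + q + n)} (h₃ : IsCompW EW Φ (p + q) Ψ₃)
    {v : Fin (p + (q + n)) → V} (hv : ∀ i, ∃ k, v i ∈ A.grading k)
    {c : ℂ} {w' : W →ₗ[ℂ] ℂ} (hw' : SupportedAt M c w') {z : Fin (p + (q + n)) → ℂ}
    (hz : ∀ i j, i < j → ‖z j‖ < ‖z i‖) (hz0 : ∀ i, z i ≠ 0) :
    pairBar w' (Ψ₂ v z) = pairBar w' (Ψ₃ (fun j => v (Fin.cast (Nat.add_assoc p q n) j))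
      (fun j => z (Fin.cast (Nat.add_assoc p q n) j))) := by
  choose wt hwt using hv
  have hnat : ∀ j : Fin n, Fin.cast (Nat.add_assoc p q n) (Fin.natAdd (p + q) j) =
      Fin.natAdd p (Fin.natAdd q j) := fun j => Fin.ext (Nat.add_assoc p q j)
  have hmid : ∀ j : Fin q, Fin.cast (Nat.add_assoc p q n) (Fin.castAdd n (Fin.natAdd p j)) =
      Fin.natAdd p (Fin.castAdd n j) := fun _ => rfl
  have hleft : ∀ i : Fin p, Fin.cast (Nat.add_assoc p q n) (Fin.castAdd n (Fin.castAdd q i)) =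
      Fin.castAdd (q + n) i := fun _ => rfl
  have s₂ := h₂.hasSum_vertexWord hEW (v := v) (fun i => hwt _) hw' hz hz0
  have s₃ := h₃.hasSum_vertexWord hEW
    (v := fun j => v (Fin.cast (Nat.add_assoc p q n) j)) (fun i => hwt _) hw'
    (z := fun j => z (Fin.cast (Nat.add_assoc p q n) j)) (fun i j hij => hz _ _ hij)
    (fun i => hz0 _)
  let a : (Fin p → ℤ) × (Fin q → ℤ) → ℂ := fun x =>
    pairBar ((w' ∘ₗ vertexWord M.Y (fun i => v (Fin.castAdd (q + n) i)) x.1) ∘ₗ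
      vertexWord M.Y (fun i => v (Fin.natAdd p (Fin.castAdd n i))) x.2)
      (Φ (fun j => v (Fin.natAdd p (Fin.natAdd q j)))
        (fun j => z (Fin.natAdd p (Fin.natAdd q j)))) *
      ((∏ i, z (Fin.castAdd (q + n) i) ^ (-x.1 i - 1)) *
        ∏ i, z (Fin.natAdd p (Fin.castAdd n i)) ^ (-x.2 i - 1))
  have sa : HasSum a (pairBar w' (Ψ₃ (fun j => v (Fin.cast (Nat.add_assoc p q n) j))
      (fun j => z (Fin.cast (Nat.add_assoc p q n) j)))) := by
    rw [← (Fin.appendEquiv p q).hasSum_iff] at s₃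
    refine hasSum_of_eq (fun x => ?_) s₃
    have happ : Fin.appendEquiv p q x = Fin.append x.1 x.2 := rfl
    rw [Function.comp_apply, happ, vertexWord_append, Fin.prod_univ_add]
    simp only [Fin.append_left, Fin.append_right, hnat, hmid, hleft]
    rw [Module.End.mul_eq_comp, ← LinearMap.comp_assoc]
  refine s₂.unique (sa.prod_fiberwise fun k => ?_)
  have s₁ := h₁.hasSum_vertexWord hEW (v := fun j => v (Fin.natAdd p j)) (fun i => hwt _)
    (hw'.comp_vertexWord (v := fun i => v (Fin.castAdd (q + n) i)) (fun i => hwt _) k)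
    (z := fun j => z (Fin.natAdd p j))
    (fun i j hij => hz _ _ ((Fin.natAdd_lt_natAdd_iff p).2 hij)) (fun i => hz0 _)
  refine hasSum_of_eq (fun l => ?_)
    (s₁.mul_right (∏ i, z (Fin.castAdd (q + n) i) ^ (-k i - 1)))
  simp only [a]
  ring

/-- Proposition 3.8, conclusion 4:
`E^{(p)}_W ∘_{p+1} (E^{(q)}_W ∘_{q+1} Φ) = E^{(p+q)}_W ∘_{p+q+1} Φ`
as `W̄`-valued rational functions on the configuration space (up to the canonical
identification `Fin (p+q+n) ≃ Fin (p+(q+n))`). -/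
theorem compW_associativity
    (A : GRVA V) (M : GRMod V W A)
    (EV : ∀ l : ℕ, (Fin l → V) → (Fin l → ℂ) → VbarT A) (hEV : IsEVFam A EV)
    (EW : ∀ m : ℕ, (Fin m → V) → W → (Fin m → ℂ) → WbarT M) (hEW : IsEWFam M EW)
    (n m p q : ℕ) (hp : 1 ≤ p) (hq : 1 ≤ q) (hpq : p + q ≤ m)
    (Φ : Cochain M n) (hrat : TakesRatValues Φ) (hcomp : Composable EV EW m Φ)
    (Ψ₁ : Cochain M (q + n)) (h₁ : IsCompW EW Φ q Ψ₁)
    (Ψ₂ : Cochain M (p + (q + n))) (h₂ : IsCompW EW Ψ₁ p Ψ₂)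
    (Ψ₃ : Cochain M (p + q + n)) (h₃ : IsCompW EW Φ (p + q) Ψ₃)
    (v : Fin (p + (q + n)) → V) (z : Fin (p + (q + n)) → ℂ)
    (hdist : ∀ s t, s ≠ t → z s ≠ z t) :
    Ψ₂ v z = Ψ₃ (fun j => v (Fin.cast (Nat.add_assoc p q n) j))
        (fun j => z (Fin.cast (Nat.add_assoc p q n) j)) := by
  let f₂ : MultilinearMap ℂ (fun _ : Fin (p + (q + n)) => V) (WbarT M) :=
    (LinearMap.proj z : ((Fin (p + (q + n)) → ℂ) → WbarT M) →ₗ[ℂ] WbarT M).compMultilinearMap Ψ₂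
  let f₃ : MultilinearMap ℂ (fun _ : Fin (p + (q + n)) => V) (WbarT M) :=
    (LinearMap.proj z : ((Fin (p + (q + n)) → ℂ) → WbarT M) →ₗ[ℂ] WbarT M).compMultilinearMap
      (transport (finCongr (Nat.add_assoc p q n)) Ψ₃)
  suffices hf : f₂ = f₃ from congrArg (fun f => f v) hf
  refine MultilinearMap.ext_of_span_eq_top
    (g := fun _ (x : {u : V // ∃ k, u ∈ A.grading k}) => (x : V)) (fun _ => ?_) fun u => ?_
  · rw [Subtype.range_coe_subtype]
    exact A.span_homogeneous
  refine WbarT.ext_pairBar fun c w' hw' => ?_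
  exact RatDiag.eq_of_ordered (h₂ (fun i => u i) w' hw'.gradedFunctionalC).1
    ((h₃ (fun j => u (Fin.cast (Nat.add_assoc p q n) j)) w' hw'.gradedFunctionalC).1.comp_cast
      (Nat.add_assoc p q n))
    (fun y hy hy0 => h₁.pairBar_eq_of_ordered hEW h₂ h₃ (fun i => (u i).2) hw' hy hy0) z hdist
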